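/- Unconditional energy stability (with equality) of the second-order Crank–Nicolson IEQ scheme: let ε ∈ ℝ, δt > 0, B ∈ ℝ, let F : ℝ → ℝ be continuously differentiable with F(s) + B > 0 for all s, set H(s) = F'(s)/√(F(s)+B), and let M : ℝ → ℝ be continuously differentiable with M(s) ≥ 0 for all s. Suppose φ^{n−1}, φⁿ, φ^{n+1}, μ, Uⁿ, U^{n+1} : ℝᵈ → ℝ are smooth ℤᵈ-periodic functions and, with φ† = (3/2)φⁿ − (1/2)φ^{n−1}, they satisfy pointwise on ℝᵈ: (φ^{n+1} − φⁿ)/δt = div(M(φ†)∇μ), μ = −ε²Δ((φ^{n+1} + φⁿ)/2) + ((U^{n+1} + Uⁿ)/2)·H(φ†), and 2(U^{n+1} − Uⁿ) = H(φ†)(φ^{n+1} − φⁿ). Then, with E(φ,U) = (ε²/2)‖∇φ‖² + ‖U‖² − B where ‖g‖² = ∫_Q |g(x)|² dx, one has (1/δt)(E(φ^{n+1},U^{n+1}) − E(φⁿ,Uⁿ)) = −∫_Q M(φ†(x)) |∇μ(x)|² dx ≤ 0. -/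

import Mathlib

open MeasureTheory Real

noncomputable section

/-- `ℝᵈ` as a Euclidean space. -/
abbrev Esp (d : ℕ) := EuclideanSpace ℝ (Fin d)

/-- The unit cell `Q = [0,1]^d`. -/
def unitCube (d : ℕ) : Set (Esp d) := {x | ∀ i, 0 ≤ x i ∧ x i ≤ 1}

/-- `ℤᵈ`-periodicity of a (scalar- or vector-valued) function on `ℝᵈ`. -/
def ZPer {d : ℕ} {α : Type*} (g : Esp d → α) : Prop :=
  ∀ (x : Esp d) (k : Fin d → ℤ),
    g (x + (WithLp.equiv 2 (Fin d → ℝ)).symm (fun i => (k i : ℝ))) = g x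

/-- Divergence of a vector field on `ℝᵈ`. -/
def pdiv {d : ℕ} (F : Esp d → Esp d) (x : Esp d) : ℝ :=
  ∑ i, fderiv ℝ (fun y => F y i) x (EuclideanSpace.single i 1)

/-- Laplacian of a scalar field on `ℝᵈ`. -/
def plap {d : ℕ} (f : Esp d → ℝ) (x : Esp d) : ℝ := pdiv (gradient f) x
lemma unitCube_eq_image (d : ℕ) :
    unitCube d = (WithLp.toLp 2 : (Fin d → ℝ) → Esp d) '' Set.Icc 0 1 := by
  ext x
  constructor
  · intro h
    exact ⟨WithLp.ofLp x, ⟨fun i => (h i).1, fun i => (h i).2⟩, rfl⟩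
  · rintro ⟨y, hy, rfl⟩ i
    exact ⟨hy.1 i, hy.2 i⟩

lemma isCompact_unitCube (d : ℕ) : IsCompact (unitCube d) := by
  rw [unitCube_eq_image]
  exact isCompact_Icc.image (PiLp.continuous_toLp 2 _)

lemma Continuous.integrableOn_unitCube {d : ℕ} {f : Esp d → ℝ} (hf : Continuous f) :
    IntegrableOn f (unitCube d) :=
  hf.continuousOn.integrableOn_compact (isCompact_unitCube d)

lemma setIntegral_unitCube {d : ℕ} (f : Esp d → ℝ) :
    ∫ x in unitCube d, f x = ∫ y in Set.Icc (0 : Fin d → ℝ) 1, f (WithLp.toLp 2 y) := by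
  rw [unitCube_eq_image]
  exact (PiLp.volume_preserving_toLp (Fin d)).setIntegral_image_emb
    (MeasurableEquiv.toLp 2 (Fin d → ℝ)).measurableEmbedding f _

lemma ContDiff.continuous_pdiv {d : ℕ} {V : Esp d → Esp d} (hV : ContDiff ℝ 1 V) :
    Continuous (pdiv V) := by
  unfold pdiv
  refine continuous_finsetSum _ fun i _ => ?_
  have h : ContDiff ℝ 1 fun y => V y i := by fun_prop
  exact (h.continuous_fderiv one_ne_zero).clm_apply continuous_const

/-- The flux of a periodic vector field through the boundary of the unit cell vanishes. -/
lemma integral_pdiv_eq_zero {d : ℕ} (hd : 1 ≤ d) {V : Esp d → Esp d} (hV : ContDiff ℝ 1 V)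
    (hp : ZPer V) : ∫ x in unitCube d, pdiv V x = 0 := by
  obtain ⟨n, rfl⟩ := Nat.exists_eq_add_of_le' hd
  have hVi (i : Fin (n + 1)) : ContDiff ℝ 1 fun y => V y i := by fun_prop
  let L : (Fin (n + 1) → ℝ) →L[ℝ] Esp (n + 1) :=
    (PiLp.continuousLinearEquiv 2 ℝ fun _ : Fin (n + 1) => ℝ).symm
  have hL (y : Fin (n + 1) → ℝ) : L y = WithLp.toLp 2 y := rfl
  have hderiv (i : Fin (n + 1)) (y : Fin (n + 1) → ℝ) :
      HasFDerivAt (fun y => V (L y) i) ((fderiv ℝ (fun y => V y i) (L y)).comp L) y :=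
    (((hVi i).differentiable one_ne_zero) (L y)).hasFDerivAt.comp y L.hasFDerivAt
  have hdiv (y : Fin (n + 1) → ℝ) : pdiv V (L y) =
      ∑ i, ((fderiv ℝ (fun y => V y i) (L y)).comp L) (Pi.single i 1) := rfl
  rw [setIntegral_unitCube]
  simp_rw [← hL, hdiv]
  rw [integral_divergence_of_hasFDerivAt_off_countable' 0 1 zero_le_one
    (fun i y => V (L y) i) (fun i y => (fderiv ℝ (fun y => V y i) (L y)).comp L) ∅
    Set.countable_empty
    (fun i => ((hVi i).continuous.comp L.continuous).continuousOn)
    (fun y _ i => hderiv i y) ?_]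
  · refine Finset.sum_eq_zero fun i _ => ?_
    rw [sub_eq_zero]
    congr 1
    funext y
    have h := hp (L (i.insertNth 0 y)) (Pi.single i 1)
    have hface : L (i.insertNth 0 y) + (WithLp.equiv 2 (Fin (n + 1) → ℝ)).symm
        (fun j => ((Pi.single i 1 : Fin (n + 1) → ℤ) j : ℝ)) = L (i.insertNth 1 y) := by
      ext j
      refine Fin.succAboveCases i ?_ (fun k => ?_) j <;> simp [hL]
    rw [hface] at h
    exact congrArg (fun v : Esp (n + 1) => v i) h
  · simp_rw [← hdiv]
    exact (hV.continuous_pdiv.comp L.continuous).continuousOn.integrableOn_compact isCompact_Icc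

lemma pdiv_smul {d : ℕ} {f : Esp d → ℝ} {V : Esp d → Esp d} {x : Esp d}
    (hf : DifferentiableAt ℝ f x) (hV : DifferentiableAt ℝ V x) :
    pdiv (fun y => f y • V y) x = f x * pdiv V x + inner ℝ (gradient f x) (V x) := by
  have hVi (i : Fin d) : DifferentiableAt ℝ (fun y => V y i) x := by fun_prop
  have hcomp (i : Fin d) : fderiv ℝ f x (EuclideanSpace.single i 1) = gradient f x i := by
    rw [← inner_gradient_left, EuclideanSpace.inner_single_right]
    simp
  simp only [pdiv, PiLp.smul_apply, smul_eq_mul, Finset.mul_sum, PiLp.inner_apply,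
    ← Finset.sum_add_distrib]
  refine Finset.sum_congr rfl fun i _ => ?_
  rw [fderiv_fun_mul hf (hVi i)]
  simp [hcomp]

lemma ContDiff.gradient_contDiff {d : ℕ} {f : Esp d → ℝ} (hf : ContDiff ℝ (⊤ : ℕ∞) f) :
    ContDiff ℝ 1 (gradient f) :=
  (InnerProductSpace.toDual ℝ (Esp d)).symm.contDiff.comp
    (hf.fderiv_right (m := 1) (WithTop.coe_le_coe.2 le_top))

lemma ZPer.gradient {d : ℕ} {f : Esp d → ℝ} (hf : ZPer f) : ZPer (gradient f) := by
  intro x k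
  have h := fderiv_comp_add_right (𝕜 := ℝ) (f := f) (x := x)
    ((WithLp.equiv 2 (Fin d → ℝ)).symm fun i => (k i : ℝ))
  simp only [hf _ k] at h
  simp only [_root_.gradient, h]

/-- Integration by parts over the unit cell for periodic functions. -/
lemma integral_mul_pdiv {d : ℕ} (hd : 1 ≤ d) {f : Esp d → ℝ} {V : Esp d → Esp d}
    (hf : ContDiff ℝ (⊤ : ℕ∞) f) (hV : ContDiff ℝ 1 V) (hpf : ZPer f) (hpV : ZPer V) :
    ∫ x in unitCube d, f x * pdiv V x =
      -∫ x in unitCube d, inner ℝ (gradient f x) (V x) := by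
  have hf1 : ContDiff ℝ 1 f := hf.of_le (by exact_mod_cast le_top)
  have h := integral_pdiv_eq_zero hd (V := fun y => f y • V y) (hf1.smul hV) fun x k => by
    simp only [hpf x k, hpV x k]
  simp_rw [pdiv_smul (hf1.differentiable one_ne_zero _) (hV.differentiable one_ne_zero _)] at h
  have hadd := integral_add (f := fun x => f x * pdiv V x)
    (hf1.continuous.mul hV.continuous_pdiv).integrableOn_unitCube
    (hf.gradient_contDiff.continuous.inner hV.continuous).integrableOn_unitCube
  linarith

/-- Unconditional energy stability (with equality) of the second-order
Crank–Nicolson IEQ scheme. -/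
theorem crank_nicolson_ieq_energy_stability (d : ℕ) (hd : 1 ≤ d)
    (ε δt B : ℝ) (hδt : 0 < δt)
    (F : ℝ → ℝ) (hF : ContDiff ℝ 1 F) (hFB : ∀ s : ℝ, 0 < F s + B)
    (H : ℝ → ℝ) (hH : ∀ s : ℝ, H s = deriv F s / Real.sqrt (F s + B))
    (M : ℝ → ℝ) (hM : ContDiff ℝ 1 M) (hM0 : ∀ s : ℝ, 0 ≤ M s)
    (φm φ0 φ1 μ U0 U1 : Esp d → ℝ)
    (hφm : ContDiff ℝ (⊤ : ℕ∞) φm) (hφ0 : ContDiff ℝ (⊤ : ℕ∞) φ0) (hφ1 : ContDiff ℝ (⊤ : ℕ∞) φ1)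
    (hμ : ContDiff ℝ (⊤ : ℕ∞) μ) (hU0 : ContDiff ℝ (⊤ : ℕ∞) U0) (hU1 : ContDiff ℝ (⊤ : ℕ∞) U1)
    (hpφm : ZPer φm) (hpφ0 : ZPer φ0) (hpφ1 : ZPer φ1) (hpμ : ZPer μ)
    (hpU0 : ZPer U0) (hpU1 : ZPer U1)
    (φd : Esp d → ℝ) (hφd : ∀ x : Esp d, φd x = 3 / 2 * φ0 x - 1 / 2 * φm x)
    (heq1 : ∀ x : Esp d,
      (φ1 x - φ0 x) / δt = pdiv (fun y => M (φd y) • gradient μ y) x)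
    (heq2 : ∀ x : Esp d,
      μ x = -ε ^ 2 * plap (fun y => (φ1 y + φ0 y) / 2) x
        + (U1 x + U0 x) / 2 * H (φd x))
    (heq3 : ∀ x : Esp d, 2 * (U1 x - U0 x) = H (φd x) * (φ1 x - φ0 x))
    (E : (Esp d → ℝ) → (Esp d → ℝ) → ℝ)
    (hE : ∀ φ U : Esp d → ℝ, E φ U =
      ε ^ 2 / 2 * (∫ x in unitCube d, ‖gradient φ x‖ ^ 2)
        + (∫ x in unitCube d, (U x) ^ 2) - B) :
    (1 / δt) * (E φ1 U1 - E φ0 U0)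
        = -∫ x in unitCube d, M (φd x) * ‖gradient μ x‖ ^ 2
      ∧ (-∫ x in unitCube d, M (φd x) * ‖gradient μ x‖ ^ 2) ≤ 0 := by
  have hφdc : ContDiff ℝ 1 φd := by
    rw [funext hφd]
    exact ((contDiff_const.mul hφ0).sub (contDiff_const.mul hφm)).of_le
      (by exact_mod_cast le_top)
  have hpφd : ZPer φd := fun x k => by simp only [hφd, hpφ0 x k, hpφm x k]
  have hdissip : ∫ x in unitCube d, μ x * ((φ1 x - φ0 x) / δt) =
      -∫ x in unitCube d, M (φd x) * ‖gradient μ x‖ ^ 2 := by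
    simp_rw [heq1]
    rw [integral_mul_pdiv hd (V := fun y => M (φd y) • gradient μ y) hμ
      ((hM.comp hφdc).smul hμ.gradient_contDiff) hpμ
      fun x k => by simp only [hpφd x k, hpμ.gradient x k]]
    simp_rw [inner_smul_right, real_inner_self_eq_norm_sq]
  have hsum : ContDiff ℝ (⊤ : ℕ∞) fun y => (φ1 y + φ0 y) / 2 := (hφ1.add hφ0).div_const 2
  have hdiff : ContDiff ℝ (⊤ : ℕ∞) fun y => φ1 y - φ0 y := hφ1.sub hφ0
  have hpsum : ZPer fun y => (φ1 y + φ0 y) / 2 := fun x k => by simp only [hpφ0 x k, hpφ1 x k]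
  have hpdiff : ZPer fun y => φ1 y - φ0 y := fun x k => by simp only [hpφ0 x k, hpφ1 x k]
  have hlap := integral_mul_pdiv hd hdiff hsum.gradient_contDiff hpdiff hpsum.gradient
  have hd0 : Differentiable ℝ φ0 := hφ0.differentiable (by simp)
  have hd1 : Differentiable ℝ φ1 := hφ1.differentiable (by simp)
  have hinner (x : Esp d) : inner ℝ (gradient (fun y => φ1 y - φ0 y) x)
      (gradient (fun y => (φ1 y + φ0 y) / 2) x) =
      1 / 2 * ‖gradient φ1 x‖ ^ 2 - 1 / 2 * ‖gradient φ0 x‖ ^ 2 := by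
    have hg1 : gradient (fun y => φ1 y - φ0 y) x = gradient φ1 x - gradient φ0 x := by
      simp only [gradient, fderiv_fun_sub (hd1 x) (hd0 x), map_sub]
    have hg2 : gradient (fun y => (φ1 y + φ0 y) / 2) x =
        (1 / 2 : ℝ) • (gradient φ1 x + gradient φ0 x) := by
      simp only [gradient, div_eq_inv_mul, fderiv_const_mul ((hd1 x).fun_add (hd0 x)),
        fderiv_fun_add (hd1 x) (hd0 x), map_smul, map_add, mul_one]
    rw [hg1, hg2, inner_smul_right, inner_sub_left, inner_add_right, inner_add_right,
      real_inner_self_eq_norm_sq, real_inner_self_eq_norm_sq, real_inner_comm]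
    ring
  have hgrad (φ : Esp d → ℝ) (hφ : ContDiff ℝ (⊤ : ℕ∞) φ) :
      IntegrableOn (fun x => 1 / 2 * ‖gradient φ x‖ ^ 2) (unitCube d) :=
    (continuous_const.mul (hφ.gradient_contDiff.continuous.norm.pow 2)).integrableOn_unitCube
  simp_rw [hinner] at hlap
  rw [integral_sub (hgrad φ1 hφ1) (hgrad φ0 hφ0), integral_const_mul, integral_const_mul] at hlap
  have hpoint (x : Esp d) : μ x * ((φ1 x - φ0 x) / δt) =
      1 / δt * (-ε ^ 2 * ((φ1 x - φ0 x) * pdiv (gradient fun y => (φ1 y + φ0 y) / 2) x)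
        + (U1 x ^ 2 - U0 x ^ 2)) := by
    rw [heq2 x, plap]
    linear_combination (-(U1 x + U0 x) / 2 / δt) * heq3 x
  have henergy : ∫ x in unitCube d, μ x * ((φ1 x - φ0 x) / δt) =
      1 / δt * (E φ1 U1 - E φ0 U0) := by
    simp_rw [hpoint]
    rw [integral_const_mul, integral_add, integral_const_mul, integral_sub, hlap, hE, hE]
    · ring
    · exact (hU1.continuous.pow 2).integrableOn_unitCube
    · exact (hU0.continuous.pow 2).integrableOn_unitCube
    · exact (continuous_const.mul
        (hdiff.continuous.mul hsum.gradient_contDiff.continuous_pdiv)).integrableOn_unitCube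
    · exact ((hU1.continuous.pow 2).sub (hU0.continuous.pow 2)).integrableOn_unitCube
  refine ⟨henergy.symm.trans hdissip, neg_nonpos.2 (integral_nonneg fun x => ?_)⟩
  exact mul_nonneg (hM0 _) (sq_nonneg _)
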